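/- arXiv:1801.00234 — 2 statements merged into one kernel-verified Lean document; each statement's English description precedes it below -/
import Mathlib

section
/- Let A ∈ ℂ^{n×n} with Hermitian part H = (A+A*)/2 having eigenvalues μ_1 ≥ ⋯ ≥ μ_n, and let V ∈ ℂ^{n×k} have orthonormal columns. If θ_1,…,θ_k are the eigenvalues of V*AV ordered with decreasing real parts, then for each j, Re θ_j ≥ M_{-(k-j+1)} := (μ_{n-(k-j+1)+1} + ⋯ + μ_n)/(k-j+1), the arithmetic mean of the k-j+1 smallest eigenvalues of H. -/
open Matrix Polynomial

/-- A unit vector is the first column of some unitary matrix. -/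
lemma exists_unitary_col_zero {k : ℕ} (v : EuclideanSpace ℂ (Fin (k + 1))) (hv : ‖v‖ = 1) :
    ∃ Q : Matrix (Fin (k + 1)) (Fin (k + 1)) ℂ, Qᴴ * Q = 1 ∧ ∀ i, Q i 0 = v i := by
  have hon : Orthonormal ℂ (({0} : Set (Fin (k + 1))).domRestrict fun _ => v) := by
    refine ⟨fun _ => hv, fun i j hij => (hij (Subsingleton.elim i j)).elim⟩
  obtain ⟨b, hb⟩ := hon.exists_orthonormalBasis_extension_of_card_eq (by simp)
  refine ⟨(EuclideanSpace.basisFun _ ℂ).toBasis.toMatrix b.toBasis, ?_, fun i => ?_⟩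
  · rw [b.coe_toBasis, ← star_eq_conjTranspose]
    exact mem_unitaryGroup_iff'.mp
      ((EuclideanSpace.basisFun _ ℂ).toMatrix_orthonormalBasis_mem_unitary b)
  · simp [Module.Basis.toMatrix_apply, hb 0 rfl]

/-- If the first column of `N` vanishes below the diagonal, its characteristic polynomial splits
off the factor of the first diagonal entry. -/
lemma charpoly_of_col_zero {R : Type*} [CommRing R] {k : ℕ}
    (N : Matrix (Fin (k + 1)) (Fin (k + 1)) R) (hN : ∀ i : Fin k, N i.succ 0 = 0) :
    N.charpoly = (X - C (N 0 0)) * (N.submatrix Fin.succ Fin.succ).charpoly := by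
  have hsub : (charmatrix N).submatrix Fin.succ Fin.succ =
      charmatrix (N.submatrix Fin.succ Fin.succ) := by
    ext1 i j
    simp [charmatrix_apply, diagonal_apply]
  rw [charpoly, det_succ_column_zero, Fin.sum_univ_succ]
  simp [hN, charpoly, ← hsub, Fin.succAbove_zero]

/-- The diagonal part of Schur's unitary triangularization: the eigenvalues can be put on the
diagonal in any prescribed order. -/
lemma exists_unitary_conj_diag {k : ℕ} (M : Matrix (Fin k) (Fin k) ℂ) (θ : Fin k → ℂ)
    (h : M.charpoly = ∏ i, (X - C (θ i))) :
    ∃ U : Matrix (Fin k) (Fin k) ℂ, Uᴴ * U = 1 ∧ ∀ i, (Uᴴ * M * U) i i = θ i := by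
  induction k with
  | zero => exact ⟨1, by simp, fun i => i.elim0⟩
  | succ k ih =>
    have hroot : M.charpoly.IsRoot (θ 0) := by
      rw [h, Fin.prod_univ_succ]; simp
    have hev : Module.End.HasEigenvalue (Matrix.toLin' M) (θ 0) := by
      rw [Module.End.hasEigenvalue_iff_isRoot_charpoly, charpoly_toLin']
      exact hroot
    obtain ⟨x, hx⟩ := hev.exists_hasEigenvector
    have hxM : M *ᵥ x = θ 0 • x := by simpa using hx.apply_eq_smul
    set y : EuclideanSpace ℂ (Fin (k + 1)) := WithLp.toLp 2 x with hy
    have hy0 : y ≠ 0 := by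
      intro h0
      exact hx.2 (by simpa [hy] using h0)
    obtain ⟨Q, hQ, hQ0⟩ := exists_unitary_col_zero (((‖y‖⁻¹ : ℝ) : ℂ) • y) (by
      rw [norm_smul]; simp [hy0])
    have hMQ : ∀ i, (M * Q) i 0 = θ 0 * Q i 0 := fun i => by
      have := congrFun hxM i
      simp only [mulVec, dotProduct, Pi.smul_apply, smul_eq_mul] at this
      simp only [mul_apply, hQ0, PiLp.smul_apply, hy, smul_eq_mul]
      rw [mul_left_comm, ← this, Finset.mul_sum]
      exact Finset.sum_congr rfl fun _ _ => by ring
    set N := Qᴴ * M * Q with hN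
    have hcol : ∀ i, N i 0 = θ 0 * (1 : Matrix (Fin (k + 1)) (Fin (k + 1)) ℂ) i 0 := fun i => by
      rw [hN, Matrix.mul_assoc, mul_apply, ← hQ, mul_apply, Finset.mul_sum]
      exact Finset.sum_congr rfl fun _ _ => by rw [hMQ]; ring
    have hN00 : N 0 0 = θ 0 := by simp [hcol]
    have hNs : ∀ i : Fin k, N i.succ 0 = 0 := fun i => by
      simp [hcol]
    have hchar : N.charpoly = M.charpoly := by
      rw [hN, charpoly_mul_comm, ← Matrix.mul_assoc, mul_eq_one_comm.mp hQ, Matrix.one_mul]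
    obtain ⟨U, hU, hUd⟩ := ih (N.submatrix Fin.succ Fin.succ) (fun i => θ i.succ) (by
      have := charpoly_of_col_zero N hNs
      rw [hchar, h, Fin.prod_univ_succ, hN00] at this
      exact (mul_left_cancel₀ (X_sub_C_ne_zero _) this).symm)
    let B : Matrix (Fin (k + 1)) (Fin (k + 1)) ℂ :=
      Matrix.of (Fin.cons (Fin.cons 1 0) fun i => Fin.cons 0 (U i))
    have hB : Bᴴ * B = 1 := by
      ext i j
      have hij : ∀ i j, ∑ a, star (U a i) * U a j = (1 : Matrix _ _ ℂ) i j := fun i j => by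
        rw [← hU]; simp [mul_apply]
      simp only [RCLike.star_def, one_apply] at hij
      refine Fin.cases ?_ (fun i => ?_) i <;> refine Fin.cases ?_ (fun j => ?_) j <;>
        simp [B, mul_apply, Fin.sum_univ_succ, one_apply, hij, Fin.succ_ne_zero,
          (Fin.succ_ne_zero _).symm]
    refine ⟨Q * B, ?_, fun i => ?_⟩
    · calc (Q * B)ᴴ * (Q * B) = Bᴴ * (Qᴴ * Q) * B := by
            simp only [conjTranspose_mul, Matrix.mul_assoc]
        _ = 1 := by rw [hQ, Matrix.mul_one, hB]
    · have hconj : (Q * B)ᴴ * M * (Q * B) = Bᴴ * N * B := by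
        simp only [hN, conjTranspose_mul, Matrix.mul_assoc]
      rw [hconj]
      refine Fin.cases ?_ (fun i => ?_) i
      · simp [B, mul_apply, Fin.sum_univ_succ, hN00]
      · rw [← hUd i]
        simp [B, mul_apply, Fin.sum_univ_succ]

/-- The rows of a matrix with orthonormal columns have norm at most one. -/
lemma sum_normSq_row_le_one {m ι : Type*} [Fintype m] [Fintype ι] [DecidableEq ι]
    (P : Matrix m ι ℂ) (hP : Pᴴ * P = 1) (l : m) : ∑ i, Complex.normSq (P l i) ≤ 1 := by
  set R := P * Pᴴ with hR
  have hRR : R * Rᴴ = R := by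
    calc R * Rᴴ = P * (Pᴴ * P) * Pᴴ := by
          simp only [hR, conjTranspose_mul, conjTranspose_conjTranspose, Matrix.mul_assoc]
      _ = R := by rw [hP, Matrix.mul_one]
  have hdiag : R l l = ((∑ i, Complex.normSq (P l i) : ℝ) : ℂ) := by
    simp [hR, mul_apply, Complex.mul_conj]
  have hsq : R l l = ((∑ q, Complex.normSq (R l q) : ℝ) : ℂ) := by
    conv_lhs => rw [← hRR]
    simp [mul_apply, Complex.mul_conj]
  have hle : Complex.normSq (R l l) ≤ ∑ q, Complex.normSq (R l q) :=
    Finset.single_le_sum (f := fun q => Complex.normSq (R l q))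
      (fun _ _ => Complex.normSq_nonneg _) (Finset.mem_univ l)
  rw [← Complex.ofReal_inj.mp (hdiag.symm.trans hsq), hdiag, Complex.normSq_ofReal] at hle
  have := Finset.sum_nonneg fun i (_ : i ∈ Finset.univ) => Complex.normSq_nonneg (P l i)
  nlinarith

/-- A combination of an antitone family with weights in `[0, 1]` of total mass `m` is at least the
sum of the last `m` members. -/
lemma sum_last_le_sum_mul {n m : ℕ} (hm : 0 < m) (hmn : m ≤ n) (μ c : Fin n → ℝ)
    (hμ : Antitone μ) (hc0 : ∀ l, 0 ≤ c l) (hc1 : ∀ l, c l ≤ 1) (hc : ∑ l, c l = m) :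
    ∑ i : Fin m, μ ⟨n - m + (i : ℕ), by omega⟩ ≤ ∑ l, μ l * c l := by
  obtain ⟨p, rfl⟩ := Nat.exists_eq_add_of_le' hmn
  have hidx : ∀ i : Fin m, (⟨p + m - m + (i : ℕ), by omega⟩ : Fin (p + m)) = Fin.natAdd p i :=
    fun i => Fin.ext (by simp)
  simp only [hidx]
  rw [Fin.sum_univ_add] at hc ⊢
  set t := μ (Fin.natAdd p ⟨0, hm⟩)
  have h1 : t * ∑ i : Fin p, c (Fin.castAdd m i) ≤
      ∑ i : Fin p, μ (Fin.castAdd m i) * c (Fin.castAdd m i) := by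
    rw [Finset.mul_sum]
    refine Finset.sum_le_sum fun i _ => mul_le_mul_of_nonneg_right (hμ ?_) (hc0 _)
    simp only [Fin.le_def, Fin.val_castAdd, Fin.val_natAdd]
    omega
  have h2 : ∑ i : Fin m, μ (Fin.natAdd p i) + t * (∑ i : Fin m, c (Fin.natAdd p i) - m) ≤
      ∑ i : Fin m, μ (Fin.natAdd p i) * c (Fin.natAdd p i) := by
    have : (m : ℝ) = ∑ _i : Fin m, (1 : ℝ) := by simp
    rw [this, ← Finset.sum_sub_distrib, Finset.mul_sum, ← Finset.sum_add_distrib]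
    refine Finset.sum_le_sum fun i _ => ?_
    have ht : μ (Fin.natAdd p i) ≤ t := hμ (by simp [Fin.le_def])
    nlinarith [hc1 (Fin.natAdd p i)]
  have h3 : ∑ i : Fin m, c (Fin.natAdd p i) - m = -∑ i : Fin p, c (Fin.castAdd m i) := by
    linarith
  rw [h3] at h2
  linarith

/-- Two finite families with the same multiset of values differ by a reindexing. -/
lemma exists_equiv_of_map_univ_eq {ι κ α : Type*} [Fintype ι] [Fintype κ] (f : ι → α) (g : κ → α)
    (h : Multiset.map f Finset.univ.val = Multiset.map g Finset.univ.val) :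
    ∃ σ : ι ≃ κ, ∀ i, g (σ i) = f i := by
  classical
  have hcard : ∀ y, Fintype.card {i // f i = y} = Fintype.card {i // g i = y} := fun y => by
    have := congrArg (Multiset.count y) h
    simp only [Multiset.count_map, ← Finset.filter_val, Finset.card_val] at this
    simpa [Fintype.card_subtype, eq_comm] using this
  let e := fun y => Fintype.equivOfCardEq (hcard y)
  exact ⟨(Equiv.sigmaFiberEquiv f).symm.trans
    ((Equiv.sigmaCongrRight e).trans (Equiv.sigmaFiberEquiv g)), fun i => (e (f i) ⟨i, rfl⟩).2⟩

/-- A Hermitian matrix is unitarily diagonalized with its eigenvalues in any prescribed order. -/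
lemma exists_unitary_diagonal {n : ℕ} (H : Matrix (Fin n) (Fin n) ℂ) (hH : H.IsHermitian)
    (μ : Fin n → ℝ) (hchar : H.charpoly = ∏ i, (X - C (μ i : ℂ))) :
    ∃ Q : Matrix (Fin n) (Fin n) ℂ, Q * Qᴴ = 1 ∧
      H = Q * diagonal (fun i => (μ i : ℂ)) * Qᴴ := by
  have hroots : Multiset.map (fun i => (μ i : ℂ)) Finset.univ.val =
      Multiset.map (fun i => (hH.eigenvalues i : ℂ)) Finset.univ.val := by
    have h := hH.roots_charpoly_eq_eigenvalues
    rw [hchar, roots_prod _ _ (Finset.prod_ne_zero_iff.mpr fun _ _ => X_sub_C_ne_zero _)] at h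
    simpa [Function.comp_def] using h
  obtain ⟨σ, hσ⟩ := exists_equiv_of_map_univ_eq _ _ hroots
  have hdiag : diagonal (fun i => (μ i : ℂ)) =
      (diagonal (fun i => (hH.eigenvalues i : ℂ))).submatrix σ σ := by
    rw [submatrix_diagonal_equiv]
    exact congrArg diagonal (funext fun i => (hσ i).symm)
  have hspec := hH.spectral_theorem
  rw [Unitary.conjStarAlgAut_apply] at hspec
  refine ⟨(hH.eigenvectorUnitary : Matrix (Fin n) (Fin n) ℂ).submatrix id σ, ?_, ?_⟩
  · rw [conjTranspose_submatrix, submatrix_mul_equiv, submatrix_id_id]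
    exact mem_unitaryGroup_iff.mp hH.eigenvectorUnitary.2
  · rw [conjTranspose_submatrix, hdiag, submatrix_mul_equiv, submatrix_mul_equiv, submatrix_id_id]
    exact hspec

/-- Carden–Embree lower bound: the j-th rightmost eigenvalue of the compression
V*AV is bounded below by the mean of the k-j+1 smallest eigenvalues of the
Hermitian part of A. -/
theorem re_ritz_ge_mean_of_smallest_hermitian_eigenvalues
    {n k : ℕ} (hkn : k ≤ n) (A : Matrix (Fin n) (Fin n) ℂ)
    (H : Matrix (Fin n) (Fin n) ℂ) (hH : H = (1/2 : ℂ) • (A + Aᴴ))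
    (μ : Fin n → ℝ) (hμ : Antitone μ)
    (hcharH : H.charpoly = ∏ i : Fin n, (X - C (μ i : ℂ)))
    (V : Matrix (Fin n) (Fin k) ℂ) (hV : Vᴴ * V = 1)
    (θ : Fin k → ℂ) (hθord : ∀ i j : Fin k, i ≤ j → (θ j).re ≤ (θ i).re)
    (hcharθ : (Vᴴ * A * V).charpoly = ∏ i : Fin k, (X - C (θ i))) :
    ∀ j : Fin k,
      (∑ i : Fin (k - (j : ℕ)), μ ⟨n - (k - (j : ℕ)) + (i : ℕ), by omega⟩)
          / (k - (j : ℕ)) ≤ (θ j).re := by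
  intro j
  have hHherm : H.IsHermitian := by
    rw [hH, IsHermitian, conjTranspose_smul, conjTranspose_add, conjTranspose_conjTranspose,
      add_comm]
    simp
  obtain ⟨Q, hQ, hHQ⟩ := exists_unitary_diagonal H hHherm μ hcharH
  obtain ⟨U, hU, hUθ⟩ := exists_unitary_conj_diag _ θ hcharθ
  set W := V * U with hW
  set P := Qᴴ * W with hP
  have hWW : Wᴴ * W = 1 := by
    calc Wᴴ * W = Uᴴ * (Vᴴ * V) * U := by simp only [hW, conjTranspose_mul, Matrix.mul_assoc]
      _ = 1 := by rw [hV, Matrix.mul_one, hU]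
  have hPP : Pᴴ * P = 1 := by
    calc Pᴴ * P = Wᴴ * (Q * Qᴴ) * W := by
          simp only [hP, conjTranspose_mul, conjTranspose_conjTranspose, Matrix.mul_assoc]
      _ = 1 := by rw [hQ, Matrix.mul_one, hWW]
  have hcol : ∀ i, ∑ l, Complex.normSq (P l i) = 1 := fun i => by
    have := congrFun (congrFun hPP i) i
    simp only [mul_apply, conjTranspose_apply, RCLike.star_def, ← Complex.normSq_eq_conj_mul_self,
      one_apply_eq] at this
    exact_mod_cast this
  have hre : ∀ i, (θ i).re = ∑ l, μ l * Complex.normSq (P l i) := fun i => by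
    have hA : Wᴴ * A * W = Uᴴ * (Vᴴ * A * V) * U := by
      simp only [hW, conjTranspose_mul, Matrix.mul_assoc]
    have hθ : (Wᴴ * A * W) i i = θ i := by rw [hA, hUθ]
    have hstar : (Wᴴ * Aᴴ * W) i i = star (θ i) := by
      rw [← hθ, ← conjTranspose_apply]
      simp only [conjTranspose_mul, conjTranspose_conjTranspose, Matrix.mul_assoc]
    have hWH : (Wᴴ * H * W) i i = ((θ i).re : ℂ) := by
      rw [hH, Matrix.mul_smul, Matrix.smul_mul, Matrix.mul_add, Matrix.add_mul, Matrix.smul_apply,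
        Matrix.add_apply, hθ, hstar, RCLike.star_def, Complex.add_conj]
      simp
    have hdiag : Wᴴ * H * W = Pᴴ * diagonal (fun i => (μ i : ℂ)) * P := by
      simp only [hHQ, hP, conjTranspose_mul, conjTranspose_conjTranspose, Matrix.mul_assoc]
    rw [hdiag, mul_apply] at hWH
    simp only [mul_diagonal, conjTranspose_apply, RCLike.star_def] at hWH
    have hterm : ∀ l, (starRingEnd ℂ) (P l i) * (μ l : ℂ) * P l i =
        ((μ l * Complex.normSq (P l i) : ℝ) : ℂ) := fun l => by
      rw [Complex.ofReal_mul, Complex.normSq_eq_conj_mul_self]; ring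
    simp only [hterm] at hWH
    exact_mod_cast hWH.symm
  have hjk : (j : ℕ) < k := j.isLt
  have hcard : ((Finset.Ici j).card : ℝ) = (k - (j : ℕ) : ℕ) := by rw [Fin.card_Ici]
  have hsum : ∑ i : Fin (k - (j : ℕ)), μ ⟨n - (k - (j : ℕ)) + (i : ℕ), by omega⟩ ≤
      ∑ i ∈ Finset.Ici j, (θ i).re := by
    calc _ ≤ ∑ l, μ l * ∑ i ∈ Finset.Ici j, Complex.normSq (P l i) := by
          refine sum_last_le_sum_mul (by omega) (by omega) μ _ hμ
            (fun l => Finset.sum_nonneg fun _ _ => Complex.normSq_nonneg _)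
            (fun l => le_trans ?_ (sum_normSq_row_le_one P hPP l)) ?_
          · exact Finset.sum_le_univ_sum_of_nonneg fun _ => Complex.normSq_nonneg _
          · rw [Finset.sum_comm, Finset.sum_congr rfl fun i _ => hcol i]
            simp
      _ = _ := by
          simp only [hre, Finset.mul_sum]
          exact Finset.sum_comm
  have hle : ∑ i ∈ Finset.Ici j, (θ i).re ≤ (k - (j : ℕ) : ℕ) * (θ j).re := by
    rw [← hcard, ← nsmul_eq_mul]
    exact Finset.sum_le_card_nsmul _ _ _ fun i hi => hθord j i (Finset.mem_Ici.mp hi)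
  have hpos : (0 : ℝ) < (k : ℝ) - (j : ℕ) := sub_pos.mpr (by exact_mod_cast hjk)
  rw [div_le_iff₀ hpos]
  rw [Nat.cast_sub hjk.le] at hle
  linarith
end

section
/- Let A ∈ ℂ^{8×8} be the lower-triangular-plus-last-column matrix with diagonal entries 1,…,8, subdiagonal entries 1, and last column (−362880, −1451520, −1693440, −846720, −211680, −28224, −2016, −64)ᵀ appropriately adjusted (the Duintjer Tebbens–Meurant example), and b = e_1. Then the Krylov subspace K_k(A,b) equals span{e_1,…,e_k} for k = 1,…,7, so with V_k = [e_1 … e_k], the compression V_k*AV_k is the leading k×k principal submatrix of A with eigenvalues {1, 2, …, k}, while σ(A) = {−1, −2, …, −8}. -/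
open Matrix Polynomial

/-- The 8×8 Duintjer Tebbens–Meurant matrix from Example 5.1. -/
noncomputable def dtmA : Matrix (Fin 8) (Fin 8) ℂ :=
  Matrix.of fun i j =>
    if j = (7 : Fin 8) then
      ![-362880, -1451520, -1693440, -846720, -211680, -28224, -2016, -64] i
    else if i = j then ((i : ℕ) + 1 : ℂ)
    else if (i : ℕ) = (j : ℕ) + 1 then 1
    else 0

/-- The starting vector b = e₁. -/
noncomputable def dtmb : Fin 8 → ℂ := Pi.single 0 1

/-- The determinant of a matrix that, outside its last column, is lower bidiagonal with
subdiagonal entries `-1`. -/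
theorem det_eq_sum_of_bidiagonal {R : Type*} [CommRing R] {n : ℕ}
    (M : Matrix (Fin (n + 1)) (Fin (n + 1)) R) (d : ℕ → R)
    (h : ∀ i j, j ≠ Fin.last n →
      M i j = if (i : ℕ) = j then d i else if (i : ℕ) = j + 1 then -1 else 0) :
    M.det = ∑ i, M i (Fin.last n) * ∏ j ∈ Finset.range i, d j := by
  induction n generalizing d with
  | zero => simp
  | succ n ih =>
    have first : M 0 0 = d 0 := by
      simp [h 0 0 (by simp [Fin.ext_iff])]
    have middle : ∀ j : Fin n, M 0 j.castSucc.succ = 0 := fun j => by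
      rw [h _ _ (by simp [Fin.ext_iff, j.isLt.ne])]
      simp
    have head : (M.submatrix Fin.succ (Fin.succAbove 0)).det =
        ∑ i : Fin (n + 1), M i.succ (Fin.last (n + 1)) *
          ∏ j ∈ Finset.range i, d (j + 1) := by
      rw [ih _ (fun j => d (j + 1))]
      · simp
      · intro i j hj
        rw [Matrix.submatrix_apply, Fin.zero_succAbove, h _ _ (by simpa [← Fin.succ_last] using hj)]
        simp
    have last : (M.submatrix Fin.succ (Fin.last (n + 1)).succAbove).det = (-1) ^ (n + 1) := by
      rw [Matrix.det_of_isUpperTriangular]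
      · simp [h]
      · intro i j hij
        have hij : (j : ℕ) < i := hij
        rw [Matrix.submatrix_apply, Fin.succAbove_last, h _ _ (Fin.castSucc_lt_last j).ne]
        rw [if_neg (by simp; omega), if_neg (by simp; omega)]
    conv_rhs => rw [Fin.sum_univ_succ]
    rw [Matrix.det_succ_row_zero, Fin.sum_univ_succ, Fin.sum_univ_castSucc, Fin.succ_last, head,
      last, first]
    simp only [middle, Fin.val_zero, Fin.val_succ, Fin.val_last, Finset.prod_range_succ',
      Finset.mul_sum]
    simp only [mul_zero, zero_mul, Finset.sum_const_zero, zero_add, pow_zero, one_mul,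
      Finset.range_zero, Finset.prod_empty, mul_one]
    rw [mul_right_comm, ← mul_pow, neg_one_mul, neg_neg, one_pow, one_mul, add_comm]
    congr 1
    exact Finset.sum_congr rfl fun i _ => by ring

theorem charpoly_dtmA : dtmA.charpoly = ∏ j : Fin 8, (X + C ((j : ℕ) + 1 : ℂ)) := by
  rw [Matrix.charpoly, det_eq_sum_of_bidiagonal _ (fun i => X - C ((i : ℂ) + 1))]
  · simp [Fin.sum_univ_succ, Fin.prod_univ_succ, Finset.prod_range_succ, charmatrix_apply, dtmA,
      Fin.ext_iff, Matrix.diagonal_apply]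
    simp only [Polynomial.C_ofNat]
    ring
  · intro i j hj
    have hj : ¬ j = 7 := hj
    simp only [charmatrix_apply, Matrix.diagonal_apply, dtmA, Matrix.of_apply, if_neg hj,
      ← Fin.ext_iff]
    split_ifs <;> simp

theorem span_image_pow_apply_eq {R M : Type*} [CommRing R] [AddCommGroup M] [Module R M]
    (T : Module.End R M) (e : ℕ → M) (d : ℕ → R) {n : ℕ}
    (h : ∀ i < n, T (e i) = d i • e i + e (i + 1)) {k : ℕ} (hk : k ≤ n + 1) :
    Submodule.span R ((fun i => (T ^ i) (e 0)) '' Set.Iio k) =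
      Submodule.span R (e '' Set.Iio k) := by
  have mono : ∀ {i j : ℕ}, i ≤ j →
      Submodule.span R (e '' Set.Iio i) ≤ Submodule.span R (e '' Set.Iio j) := fun hij =>
    Submodule.span_mono (Set.image_mono (Set.Iio_subset_Iio hij))
  have mem : ∀ {i j : ℕ}, i < j → e i ∈ Submodule.span R (e '' Set.Iio j) := fun hij =>
    Submodule.subset_span (Set.mem_image_of_mem e hij)
  have sub_mem : ∀ i ≤ n, (T ^ i) (e 0) - e i ∈ Submodule.span R (e '' Set.Iio i) := by
    intro i
    induction i with
    | zero => simp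
    | succ i ih =>
      intro hi
      have maps : Submodule.span R (e '' Set.Iio i) ≤
          (Submodule.span R (e '' Set.Iio (i + 1))).comap T := by
        rw [Submodule.span_le]
        rintro _ ⟨j, hj, rfl⟩
        have hj : j < i := hj
        rw [SetLike.mem_coe, Submodule.mem_comap, h j (by omega)]
        exact add_mem (Submodule.smul_mem _ _ (mem (by omega))) (mem (by omega))
      have key : (T ^ (i + 1)) (e 0) - e (i + 1) = T ((T ^ i) (e 0) - e i) + d i • e i := by
        rw [map_sub, h i (by omega), pow_succ', Module.End.mul_apply]
        abel
      rw [key]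
      exact add_mem (maps (ih (by omega))) (Submodule.smul_mem _ _ (mem (by omega)))
  induction k with
  | zero => simp
  | succ k ih =>
    have hIio : Set.Iio (k + 1) = insert k (Set.Iio k) := by ext; simp
    have hs := sub_mem k (by omega)
    rw [hIio, Set.image_insert_eq, Set.image_insert_eq, Submodule.span_insert,
      Submodule.span_insert, ih (by omega)]
    apply le_antisymm <;> refine sup_le ?_ le_sup_right <;>
      rw [Submodule.span_singleton_le_iff_mem, Submodule.mem_sup]
    · exact ⟨_, Submodule.mem_span_singleton_self _, _, hs, by abel⟩
    · exact ⟨_, Submodule.mem_span_singleton_self _, _, neg_mem hs, by abel⟩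

/-- The standard basis of `ℂ⁸`, indexed by `ℕ` and extended by zero. -/
def stdVec (i : ℕ) : Fin 8 → ℂ := fun j => if (j : ℕ) = i then 1 else 0

theorem stdVec_val (i : Fin 8) : stdVec i = Pi.single i 1 := by
  ext j
  simp [stdVec, Pi.single_apply, Fin.ext_iff]

theorem dtmA_mulVec_stdVec {i : ℕ} (hi : i < 7) :
    dtmA *ᵥ stdVec i = ((i : ℂ) + 1) • stdVec i + stdVec (i + 1) := by
  have hs : stdVec i = Pi.single (⟨i, by omega⟩ : Fin 8) 1 := stdVec_val ⟨i, by omega⟩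
  ext j
  rw [hs, mulVec_single_one, ← hs]
  simp only [Matrix.col_apply, dtmA, Matrix.of_apply, Fin.ext_iff, stdVec, Pi.add_apply,
    Pi.smul_apply, smul_eq_mul]
  rw [if_neg (show ¬ i = ((7 : Fin 8) : ℕ) from by simp; omega)]
  split_ifs <;> first | omega | simp_all

theorem span_krylov_dtmA {k : ℕ} (hk : k ≤ 8) :
    Submodule.span ℂ (Set.range fun i : Fin k => (dtmA ^ (i : ℕ)) *ᵥ dtmb) =
      Submodule.span ℂ
        (Set.range fun i : Fin k => (Pi.single (Fin.castLE hk i) 1 : Fin 8 → ℂ)) := by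
  have h := span_image_pow_apply_eq (Matrix.toLin' dtmA) stdVec (fun i => (i : ℂ) + 1) (n := 7)
    (fun i hi => by rw [Matrix.toLin'_apply, dtmA_mulVec_stdVec hi]) hk
  have range_val : ∀ f : ℕ → Fin 8 → ℂ, (Set.range fun i : Fin k => f i) = f '' Set.Iio k := by
    intro f
    rw [← Fin.range_val, ← Set.range_comp]
    rfl
  have hb : dtmb = stdVec 0 := (stdVec_val 0).symm
  simp_rw [← stdVec_val, Fin.val_castLE, hb]
  rw [range_val (fun i => (dtmA ^ i) *ᵥ stdVec 0), range_val stdVec, ← h]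
  simp_rw [← Matrix.toLin'_pow, Matrix.toLin'_apply]

theorem conjTranspose_mul_mul_eq_submatrix {R : Type*} [Semiring R] [StarRing R] {n k : ℕ}
    (hk : k ≤ n) (M : Matrix (Fin n) (Fin n) R) :
    (Matrix.of fun (i : Fin n) (j : Fin k) => if (i : ℕ) = (j : ℕ) then (1 : R) else 0)ᴴ * M *
        (Matrix.of fun (i : Fin n) (j : Fin k) => if (i : ℕ) = (j : ℕ) then (1 : R) else 0) =
      M.submatrix (Fin.castLE hk) (Fin.castLE hk) := by
  have heq : ∀ (i : Fin n) (j : Fin k), (i : ℕ) = j ↔ i = Fin.castLE hk j := by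
    simp [Fin.ext_iff]
  ext i j
  simp [Matrix.mul_apply, heq, apply_ite star]

theorem charpoly_submatrix_dtmA {k : ℕ} (hk : k < 8) :
    (dtmA.submatrix (Fin.castLE hk.le) (Fin.castLE hk.le)).charpoly =
      ∏ i : Fin k, (X - C ((i : ℕ) + 1 : ℂ)) := by
  have hne : ∀ j : Fin k, (j : ℕ) ≠ ((7 : Fin 8) : ℕ) := fun j => by
    have := j.isLt
    simp; omega
  rw [← Matrix.charpoly_transpose, Matrix.charpoly_of_isUpperTriangular]
  · refine Finset.prod_congr rfl fun i _ => ?_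
    simp only [Matrix.transpose_apply, Matrix.submatrix_apply, dtmA, Matrix.of_apply,
      Fin.ext_iff, Fin.val_castLE, if_neg (hne i), if_true]
  · intro i j hij
    have hij : (j : ℕ) < i := hij
    simp only [Matrix.transpose_apply, Matrix.submatrix_apply, dtmA, Matrix.of_apply,
      Fin.ext_iff, Fin.val_castLE]
    rw [if_neg (hne _), if_neg (by omega), if_neg (by omega)]

theorem dtm_example :
    (dtmA.charpoly = ∏ j : Fin 8, (X + C ((j : ℕ) + 1 : ℂ))) ∧
    (∀ k : ℕ, 1 ≤ k → (hk : k ≤ 7) →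
      Submodule.span ℂ (Set.range fun i : Fin k => (dtmA ^ (i : ℕ)) *ᵥ dtmb)
        = Submodule.span ℂ
            (Set.range fun i : Fin k =>
              (Pi.single (Fin.castLE (by omega) i) 1 : Fin 8 → ℂ))) ∧
    (∀ k : ℕ, 1 ≤ k → (hk : k ≤ 7) →
      ∀ V : Matrix (Fin 8) (Fin k) ℂ,
        V = Matrix.of (fun (i : Fin 8) (j : Fin k) => if (i : ℕ) = (j : ℕ) then 1 else 0) →
        (Vᴴ * dtmA * V
            = Matrix.of (fun i j : Fin k =>
                dtmA (Fin.castLE (by omega) i) (Fin.castLE (by omega) j))) ∧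
        (Vᴴ * dtmA * V).charpoly = ∏ i : Fin k, (X - C ((i : ℕ) + 1 : ℂ))) := by
  refine ⟨charpoly_dtmA, fun k _ hk => span_krylov_dtmA (by omega), ?_⟩
  rintro k - hk V rfl
  rw [conjTranspose_mul_mul_eq_submatrix (by omega : k ≤ 8)]
  exact ⟨rfl, charpoly_submatrix_dtmA (by omega)⟩
end
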